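/- Let Ω be a triangle with sides S, M, L ordered nondecreasingly by length, and suppose both interior angles adjacent to the shortest side S are strictly less than π/2. Then λ₁^S ≤ λ₁^{L∪M}. -/

import Mathlib

open MeasureTheory EuclideanGeometry Real

noncomputable section

/-- Points of the plane. -/
abbrev Pt := EuclideanSpace ℝ (Fin 2)

/-- `i`-th partial derivative of `u`. -/
def pd (i : Fin 2) (u : Pt → ℝ) (x : Pt) : ℝ := fderiv ℝ u x (EuclideanSpace.single i 1)

/-- Second partial derivative `∂ᵢ∂ⱼ u`. -/
def pdd (i j : Fin 2) (u : Pt → ℝ) : Pt → ℝ := pd i (pd j u)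

/-- A (closed, nondegenerate) line segment in the plane. -/
def IsSegSet (s : Set Pt) : Prop := ∃ a b : Pt, a ≠ b ∧ s = segment ℝ a b

/-- `Ω` is an open bounded convex polygon whose boundary is the union of the finitely
many sides in `Sides`. -/
def IsConvexPolygon (Ω : Set Pt) (Sides : Finset (Set Pt)) : Prop :=
  IsOpen Ω ∧ Convex ℝ Ω ∧ Bornology.IsBounded Ω ∧ Ω.Nonempty ∧
    (∀ s ∈ Sides, IsSegSet s) ∧ frontier Ω = ⋃ s ∈ Sides, s

/-- `Γ` is the union of the sides in the subcollection `T` of `Sides`. -/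
def UnionOfSides (Γ : Set Pt) (Sides T : Finset (Set Pt)) : Prop :=
  T ⊆ Sides ∧ Γ = ⋃ s ∈ T, s

/-- `n` is the outward unit normal of `Ω` along the side `s`. -/
def IsOuterNormal (Ω s : Set Pt) (n : Pt) : Prop :=
  ‖n‖ = 1 ∧ ∀ x ∈ s, ∀ y ∈ Ω, n 0 * (y 0 - x 0) + n 1 * (y 1 - x 1) ≤ 0

/-- `u` satisfies a (pointwise) Neumann boundary condition on the side `s` of `Ω`. -/
def NeumannOn (Ω s : Set Pt) (u : Pt → ℝ) : Prop :=
  ∃ n : Pt, IsOuterNormal Ω s n ∧ ∀ x ∈ s, pd 0 u x * n 0 + pd 1 u x * n 1 = 0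

/-- (Regular representative of) membership in `H²(Ω)`. -/
def MemH2 (Ω : Set Pt) (u : Pt → ℝ) : Prop := ContDiffOn ℝ 2 u (closure Ω)

/-- (Regular representative of) membership in `H¹(Ω)`. -/
def MemH1 (Ω : Set Pt) (u : Pt → ℝ) : Prop := ContDiffOn ℝ 1 u (closure Ω)

/-- The set of Rayleigh quotients of admissible test functions vanishing on `Sig`. -/
def RayleighSet (Ω Sig : Set Pt) : Set ℝ :=
  { r | ∃ u : Pt → ℝ, MemH1 Ω u ∧ (∀ x ∈ Sig, u x = 0) ∧ (∫ x in Ω, (u x) ^ 2) ≠ 0 ∧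
      r = (∫ x in Ω, ((pd 0 u x) ^ 2 + (pd 1 u x) ^ 2)) / (∫ x in Ω, (u x) ^ 2) }

/-- The lowest eigenvalue `λ₁^Σ` of the mixed Dirichlet(Σ)–Neumann Laplacian on `Ω`,
as the infimum of the Rayleigh quotient. -/
def lambda1 (Ω Sig : Set Pt) : ℝ := sInf (RayleighSet Ω Sig)


/-- One-dimensional Dirichlet inequality. -/
lemma slice_ineq (s : ℝ) (hs0 : 0 ≤ s) (hs1 : s ≤ 1) (F F' : ℝ → ℝ)
    (hF : ContinuousOn F (Set.Icc 0 s)) (hF' : ContinuousOn F' (Set.Icc 0 s))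
    (hd : ∀ t ∈ Set.Ioo 0 s, HasDerivAt F (F' t) t) (h0 : F 0 = 0) (h1 : F s = 0) :
    0 ≤ ∫ t in Set.Icc 0 s, ((F' t) ^ 2 - 9 * (F t) ^ 2) := by
  have hcos : ∀ t ∈ Set.Icc 0 s, Real.cos (3 * (t - s / 2)) ≠ 0 := by
    intro t ht
    have hpi := Real.pi_gt_three
    apply ne_of_gt
    apply Real.cos_pos_of_mem_Ioo
    constructor <;> linarith [ht.1, ht.2]
  have hint : IntegrableOn (fun t => (F' t) ^ 2 - 9 * (F t) ^ 2) (Set.Icc 0 s) := by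
    apply ContinuousOn.integrableOn_Icc
    fun_prop
  set g : ℝ → ℝ := fun t => -3 * Real.tan (3 * (t - s / 2)) with hg
  have hgd : ∀ t ∈ Set.Icc 0 s, HasDerivAt g (-9 - (g t) ^ 2) t := by
    intro t ht
    have h := hcos t ht
    have h2 : HasDerivAt (fun t : ℝ => 3 * (t - s / 2)) (3 * 1) t :=
      ((hasDerivAt_id t).sub_const _).const_mul 3
    have h3 := ((Real.hasDerivAt_tan h).comp t h2).const_mul (-3)
    refine HasDerivAt.congr_deriv (f := g) h3 ?_
    simp only [hg, Real.tan_eq_sin_div_cos]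
    generalize 3 * (t - s / 2) = a at h
    field_simp
    nlinarith [Real.sin_sq_add_cos_sq a]
  have hgc : ContinuousOn g (Set.Icc 0 s) := fun t ht => (hgd t ht).continuousAt.continuousWithinAt
  have key := intervalIntegral.sub_le_integral_of_hasDeriv_right_of_le
    (g := fun t => g t * (F t) ^ 2)
    (g' := fun t => (-9 - (g t) ^ 2) * (F t) ^ 2 + g t * (2 * F t * F' t))
    (φ := fun t => (F' t) ^ 2 - 9 * (F t) ^ 2) hs0 (by fun_prop)
    (by
      intro t ht
      have hh := (hgd t (Set.Ioo_subset_Icc_self ht)).mul ((hd t ht).pow 2)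
      refine HasDerivAt.hasDerivWithinAt ?_
      refine HasDerivAt.congr_deriv hh ?_
      simp only [Pi.pow_apply]
      push_cast
      ring)
    hint
    (by
      intro t ht
      nlinarith [sq_nonneg (F' t - g t * F t)])
  simp only [h0, h1] at key
  rw [intervalIntegral.integral_of_le hs0, ← integral_Icc_eq_integral_Ioc] at key
  simpa using key

/-- Reference triangle. -/
def TT : Set (ℝ × ℝ) := {z | 0 ≤ z.2 ∧ z.2 ≤ z.1 ∧ z.1 ≤ 1}

lemma TT_compact : IsCompact TT := by
  apply IsCompact.of_isClosed_subset (isCompact_Icc : IsCompact (Set.Icc ((0:ℝ),(0:ℝ)) (1,1)))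
  · apply IsClosed.and
    · exact isClosed_le continuous_const continuous_snd
    · apply IsClosed.and
      · exact isClosed_le continuous_snd continuous_fst
      · exact isClosed_le continuous_fst continuous_const
  · rintro ⟨s, t⟩ ⟨h1, h2, h3⟩
    refine ⟨⟨?_, ?_⟩, ⟨?_, ?_⟩⟩ <;> dsimp only at * <;> linarith

lemma TT_fubini (G : ℝ × ℝ → ℝ) (hG : ContinuousOn G TT) :
    ∫ z in TT, G z = ∫ s in Set.Icc (0:ℝ) 1, ∫ t in Set.Icc 0 s, G (s, t) := by
  have hm := TT_compact.isClosed.measurableSet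
  have hi : Integrable (TT.indicator G) :=
    (integrable_indicator_iff hm).2 (hG.integrableOn_compact TT_compact)
  rw [← integral_indicator hm, Measure.volume_eq_prod, integral_prod _ hi,
    ← integral_indicator measurableSet_Icc]
  congr 1
  ext s
  by_cases hs : s ∈ Set.Icc (0:ℝ) 1
  · rw [Set.indicator_of_mem hs, ← integral_indicator measurableSet_Icc]
    congr 1
    ext t
    by_cases ht : t ∈ Set.Icc 0 s
    · rw [Set.indicator_of_mem ht, Set.indicator_of_mem]
      exact ⟨ht.1, ht.2, hs.2⟩
    · rw [Set.indicator_of_notMem ht, Set.indicator_of_notMem]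
      exact fun h => ht ⟨h.1, h.2.1⟩
  · rw [Set.indicator_of_notMem hs]
    convert integral_zero ℝ ℝ with t
    rw [Set.indicator_of_notMem]
    exact fun h => hs ⟨h.1.trans h.2.1, h.2.2⟩

lemma TT_test : ∫ z in TT, (6 * (1 - z.1) ^ 2 - 1) = 0 := by
  rw [TT_fubini _ (by fun_prop)]
  have : ∀ s ∈ Set.Icc (0:ℝ) 1, (∫ t in Set.Icc 0 s, (6 * (1 - ((s, t) : ℝ × ℝ).1) ^ 2 - 1))
      = s * (6 * (1 - s) ^ 2 - 1) := by
    intro s hs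
    simp [hs.1]
  rw [setIntegral_congr_fun measurableSet_Icc this, integral_Icc_eq_integral_Ioc,
    ← intervalIntegral.integral_of_le zero_le_one]
  have h : ∀ x ∈ Set.uIcc (0:ℝ) 1, HasDerivAt (fun x : ℝ => 6 * (x^2/2 - 2 * x^3/3 + x^4/4) - x^2/2)
      (x * (6 * (1 - x) ^ 2 - 1)) x := by
    intro x _
    have := ((((hasDerivAt_pow 2 x).div_const 2).sub (((hasDerivAt_pow 3 x).const_mul 2).div_const 3)).add
      ((hasDerivAt_pow 4 x).div_const 4)).const_mul 6 |>.sub ((hasDerivAt_pow 2 x).div_const 2)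
    refine HasDerivAt.congr_deriv this ?_
    push_cast
    ring
  rw [intervalIntegral.integral_eq_sub_of_hasDerivAt h (by apply Continuous.intervalIntegrable; fun_prop)]
  norm_num

/-- The linear parametrization. -/
def eqv (p v : Pt) (hδ : p 0 * v 1 - p 1 * v 0 ≠ 0) : (ℝ × ℝ) ≃L[ℝ] Pt :=
  LinearEquiv.toContinuousLinearEquiv
  { toFun := fun z => z.1 • p + z.2 • v
    map_add' := by intro x y; simp only [Prod.fst_add, Prod.snd_add, add_smul]; abel
    map_smul' := by intro r x; simp [smul_smul]
    invFun := fun y => ((y 0 * v 1 - y 1 * v 0) / (p 0 * v 1 - p 1 * v 0),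
      (p 0 * y 1 - p 1 * y 0) / (p 0 * v 1 - p 1 * v 0))
    left_inv := by
      rintro ⟨s, t⟩
      ext
      · simp only [PiLp.add_apply, PiLp.smul_apply, smul_eq_mul]
        rw [div_eq_iff hδ]; ring
      · simp only [PiLp.add_apply, PiLp.smul_apply, smul_eq_mul]
        rw [div_eq_iff hδ]; ring
    right_inv := by
      intro y
      ext i
      fin_cases i <;>
      · simp only [PiLp.add_apply, PiLp.smul_apply, smul_eq_mul, Fin.zero_eta, Fin.mk_one]
        rw [div_mul_eq_mul_div, div_mul_eq_mul_div, ← add_div, div_eq_iff hδ]; ring }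

lemma eqv_apply (p v : Pt) (hδ : p 0 * v 1 - p 1 * v 0 ≠ 0) (z : ℝ × ℝ) :
    eqv p v hδ z = z.1 • p + z.2 • v := rfl

lemma change_var (A p v : Pt) (hδ : p 0 * v 1 - p 1 * v 0 ≠ 0) (K : Set Pt)
    (hT : ∀ z : ℝ × ℝ, A + z.1 • p + z.2 • v ∈ K ↔ z ∈ TT) :
    ∃ c : ℝ, 0 ≤ c ∧ ∀ f : Pt → ℝ,
      ∫ x in K, f x = c * ∫ z in TT, f (A + z.1 • p + z.2 • v) := by
  set e := eqv p v hδ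
  have hH : (Measure.map e (volume : Measure (ℝ × ℝ))).IsAddHaarMeasure :=
    e.isAddHaarMeasure_map volume
  have h := Measure.isAddLeftInvariant_eq_smul (volume : Measure Pt) (Measure.map e volume)
  set c := Measure.addHaarScalarFactor (volume : Measure Pt) (Measure.map e volume)
  have hmap : Measure.map (fun z => A + e z) (volume : Measure (ℝ × ℝ)) = Measure.map e volume := by
    rw [← map_add_left_eq_self (Measure.map e volume) A, Measure.map_map (by fun_prop) (by fun_prop)]
    rfl
  have hemb : MeasurableEmbedding (fun z => A + e z) :=
    ((e.toHomeomorph.trans (Homeomorph.addLeft A)).measurableEmbedding)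
  refine ⟨c, c.2, fun f => ?_⟩
  rw [h, Measure.restrict_smul, integral_smul_nnreal_measure, ← hmap, hemb.setIntegral_map]
  have : (fun z => A + e z) ⁻¹' K = TT := by
    ext z
    rw [← hT]
    simp only [Set.mem_preimage, e, eqv_apply, add_assoc]
  rw [this]
  simp only [e, eqv_apply, ← add_assoc]
  rfl

lemma dirichlet_ineq (A p v : Pt) (hδ : p 0 * v 1 - p 1 * v 0 ≠ 0) (K : Set Pt)
    (hT : ∀ z : ℝ × ℝ, A + z.1 • p + z.2 • v ∈ K ↔ z ∈ TT)
    (hin : ∀ s t : ℝ, 0 < t → t < s → s < 1 → A + s • p + t • v ∈ interior K)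
    (u : Pt → ℝ) (hu : ContinuousOn u K)
    (hud : ∀ x ∈ interior K, DifferentiableAt ℝ u x) (D : Pt → ℝ) (hD : ContinuousOn D K)
    (hDe : ∀ x ∈ interior K, D x = fderiv ℝ u x v)
    (h0 : ∀ s : ℝ, 0 ≤ s → s ≤ 1 → u (A + s • p) = 0)
    (h1 : ∀ s : ℝ, 0 ≤ s → s ≤ 1 → u (A + s • p + s • v) = 0) :
    0 ≤ ∫ x in K, ((D x) ^ 2 - 9 * (u x) ^ 2) := by
  obtain ⟨c, hc, hcv⟩ := change_var A p v hδ K hT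
  rw [hcv]
  apply mul_nonneg hc
  have hmaps : Set.MapsTo (fun z : ℝ × ℝ => A + z.1 • p + z.2 • v) TT K := fun z hz => (hT z).2 hz
  have hΦ : Continuous (fun z : ℝ × ℝ => A + z.1 • p + z.2 • v) := by fun_prop
  have hu' : ContinuousOn (fun z : ℝ × ℝ => u (A + z.1 • p + z.2 • v)) TT :=
    hu.comp hΦ.continuousOn hmaps
  have hD' : ContinuousOn (fun z : ℝ × ℝ => D (A + z.1 • p + z.2 • v)) TT :=
    hD.comp hΦ.continuousOn hmaps
  rw [TT_fubini (fun z : ℝ × ℝ => D (A + z.1 • p + z.2 • v) ^ 2 -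
    9 * u (A + z.1 • p + z.2 • v) ^ 2) (by fun_prop)]
  suffices hpos : ∀ s ∈ Set.Ico (0:ℝ) 1, 0 ≤ ∫ t in Set.Icc 0 s,
      (D (A + s • p + t • v) ^ 2 - 9 * u (A + s • p + t • v) ^ 2) by
    rw [integral_Icc_eq_integral_Ico]
    exact setIntegral_nonneg measurableSet_Ico hpos
  intro s hs
  have hsl : ContinuousOn (fun t : ℝ => A + s • p + t • v) (Set.Icc 0 s) := by fun_prop
  have hslm : Set.MapsTo (fun t : ℝ => A + s • p + t • v) (Set.Icc 0 s) K :=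
    fun t ht => (hT (s, t)).2 ⟨ht.1, ht.2, hs.2.le⟩
  have hu2 : ContinuousOn (fun t : ℝ => u (A + s • p + t • v)) (Set.Icc 0 s) :=
    hu.comp hsl hslm
  have hD2 : ContinuousOn (fun t : ℝ => D (A + s • p + t • v)) (Set.Icc 0 s) :=
    hD.comp hsl hslm
  refine slice_ineq s hs.1 hs.2.le (fun t => u (A + s • p + t • v)) (fun t => D (A + s • p + t • v))
    hu2 hD2 ?_ ?_ ?_
  · intro t ht
    have hi := hin s t ht.1 ht.2 hs.2
    have h2 : HasDerivAt (fun t : ℝ => A + s • p + t • v) ((1:ℝ) • v) t :=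
      ((hasDerivAt_id t).smul_const v).const_add _
    have h3 := (hud _ hi).hasFDerivAt.comp_hasDerivAt t h2
    rw [one_smul] at h3
    rw [hDe _ hi]
    exact h3
  · simpa using h0 s hs.1 hs.2.le
  · exact h1 s hs.1 hs.2.le

lemma test_int (A p v : Pt) (hδ : p 0 * v 1 - p 1 * v 0 ≠ 0) (K : Set Pt)
    (hT : ∀ z : ℝ × ℝ, A + z.1 • p + z.2 • v ∈ K ↔ z ∈ TT) (u : Pt → ℝ)
    (hu : ∀ s t : ℝ, u (A + s • p + t • v) = 1 - s) :
    ∫ x in K, (6 * (u x) ^ 2 - 1) = 0 := by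
  obtain ⟨c, hc, hcv⟩ := change_var A p v hδ K hT
  rw [hcv]
  simp only [hu, TT_test, mul_zero]

/-- first barycentric-type coordinate -/
def sF (A p v : Pt) (x : Pt) : ℝ :=
  ((x 0 - A 0) * v 1 - (x 1 - A 1) * v 0) / (p 0 * v 1 - p 1 * v 0)

/-- second barycentric-type coordinate -/
def tF (A p v : Pt) (x : Pt) : ℝ :=
  (p 0 * (x 1 - A 1) - p 1 * (x 0 - A 0)) / (p 0 * v 1 - p 1 * v 0)

lemma sF_apply (A p v : Pt) (hδ : p 0 * v 1 - p 1 * v 0 ≠ 0) (s t : ℝ) :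
    sF A p v (A + s • p + t • v) = s := by
  simp only [sF, PiLp.add_apply, PiLp.smul_apply, smul_eq_mul]
  rw [div_eq_iff hδ]; ring

lemma tF_apply (A p v : Pt) (hδ : p 0 * v 1 - p 1 * v 0 ≠ 0) (s t : ℝ) :
    tF A p v (A + s • p + t • v) = t := by
  simp only [tF, PiLp.add_apply, PiLp.smul_apply, smul_eq_mul]
  rw [div_eq_iff hδ]; ring

lemma sF_hasFDerivAt (A p v x : Pt) : HasFDerivAt (sF A p v)
    ((v 1 / (p 0 * v 1 - p 1 * v 0)) • (EuclideanSpace.proj 0 : Pt →L[ℝ] ℝ)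
      - (v 0 / (p 0 * v 1 - p 1 * v 0)) • (EuclideanSpace.proj 1 : Pt →L[ℝ] ℝ)) x := by
  set ℓ := ((v 1 / (p 0 * v 1 - p 1 * v 0)) • (EuclideanSpace.proj 0 : Pt →L[ℝ] ℝ)
      - (v 0 / (p 0 * v 1 - p 1 * v 0)) • (EuclideanSpace.proj 1 : Pt →L[ℝ] ℝ)) with hℓ
  have h := ℓ.hasFDerivAt (x := x) |>.sub_const (ℓ A)
  have : sF A p v = fun y => ℓ y - ℓ A := by
    ext y
    simp [hℓ, sF]
    ring
  rw [this]
  exact h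

lemma sF_contDiff (A p v : Pt) : ContDiff ℝ 1 (sF A p v) := by unfold sF; fun_prop
lemma tF_contDiff (A p v : Pt) : ContDiff ℝ 1 (tF A p v) := by unfold tF; fun_prop

lemma mem_tri (A B C : Pt) (z : ℝ × ℝ)
    (hδ : (B - A) 0 * (C - B) 1 - (B - A) 1 * (C - B) 0 ≠ 0) :
    A + z.1 • (B - A) + z.2 • (C - B) ∈ convexHull ℝ {A, B, C} ↔ z ∈ TT := by
  constructor
  · intro h
    set e := eqv (B - A) (C - B) hδ
    have hsub : convexHull ℝ {A, B, C} ⊆ (fun z => A + e z) '' TT := by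
      apply convexHull_min
      · rintro x (rfl | rfl | rfl)
        · exact ⟨(0, 0), by simp [TT], by simp [e, eqv_apply]⟩
        · exact ⟨(1, 0), by simp [TT], by simp [e, eqv_apply]⟩
        · exact ⟨(1, 1), by simp [TT], by simp [e, eqv_apply]⟩
      · rintro _ ⟨⟨s, t⟩, ⟨h1, h2, h3⟩, rfl⟩ _ ⟨⟨s', t'⟩, ⟨h1', h2', h3'⟩, rfl⟩ a b ha hb hab
        refine ⟨(a * s + b * s', a * t + b * t'), ⟨?_, ?_, ?_⟩, ?_⟩
        · dsimp only at *; positivity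
        · dsimp only at *; gcongr
        · dsimp only at *; nlinarith
        · obtain rfl : b = 1 - a := by linarith
          simp only [e, eqv_apply]
          module
    obtain ⟨z', hz', he⟩ := hsub h
    have : e z' = e z := by
      have : A + e z' = A + e z := by
        refine he.trans ?_
        simp only [e, eqv_apply, add_assoc]
      exact add_left_cancel this
    rwa [← e.injective this]
  · rintro ⟨h1, h2, h3⟩
    have hA : A ∈ convexHull ℝ {A, B, C} := subset_convexHull _ _ (by simp)
    have hB : B ∈ convexHull ℝ {A, B, C} := subset_convexHull _ _ (by simp)
    have hC : C ∈ convexHull ℝ {A, B, C} := subset_convexHull _ _ (by simp)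
    have hcv := convex_convexHull ℝ ({A, B, C} : Set Pt)
    have := hcv.sum_mem (t := Finset.univ) (w := ![1 - z.1, z.1 - z.2, z.2]) (z := ![A, B, C])
      (by intro i _; fin_cases i <;> simp <;> linarith)
      (by simp [Fin.sum_univ_three])
      (by intro i _; fin_cases i <;> simp [hA, hB, hC])
    convert this using 1
    simp only [Fin.sum_univ_three, Matrix.cons_val]
    module

lemma tri_det (A B C : Pt) (hnd : AffineIndependent ℝ ![A, B, C]) :
    (B - A) 0 * (C - B) 1 - (B - A) 1 * (C - B) 0 ≠ 0 := by
  intro h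
  rw [affineIndependent_iff] at hnd
  have key : ∀ a b : ℝ, a • (B - A) + b • (C - B) = 0 → a = 0 ∧ b = 0 := by
    intro a b hab
    have h3 := hnd Finset.univ ![-a, a - b, b] (by simp [Fin.sum_univ_three]; ring) (by
      simp only [Fin.sum_univ_three, Matrix.cons_val]
      rw [← hab]; module)
    have ha := h3 0 (by simp)
    have hb := h3 2 (by simp)
    simp at ha hb
    exact ⟨ha, hb⟩
  have k1 := key ((C - B) 1) (-(B - A) 1) (by
    ext i
    fin_cases i <;> simp only [PiLp.add_apply, PiLp.smul_apply, smul_eq_mul, Fin.zero_eta, Fin.mk_one, PiLp.zero_apply] <;> linarith)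
  have k2 := key ((C - B) 0) (-(B - A) 0) (by
    ext i
    fin_cases i <;> simp only [PiLp.add_apply, PiLp.smul_apply, smul_eq_mul, Fin.zero_eta, Fin.mk_one, PiLp.zero_apply] <;> linarith)
  have k3 := key 1 0 (by
    ext i
    fin_cases i <;> simp only [PiLp.add_apply, PiLp.smul_apply, smul_eq_mul, Fin.zero_eta, Fin.mk_one, PiLp.zero_apply] <;> linarith)
  exact one_ne_zero k3.1

lemma tri_interior (A B C : Pt)
    (hδ : (B - A) 0 * (C - B) 1 - (B - A) 1 * (C - B) 0 ≠ 0) (s t : ℝ)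
    (h1 : 0 < t) (h2 : t < s) (h3 : s < 1) :
    A + s • (B - A) + t • (C - B) ∈ interior (convexHull ℝ {A, B, C}) := by
  set e := (eqv (B - A) (C - B) hδ).toHomeomorph.trans (Homeomorph.addLeft A) with he
  have hap : ∀ z, e z = A + z.1 • (B - A) + z.2 • (C - B) := by
    intro z
    simp [he, eqv_apply, add_assoc]
  rw [mem_interior]
  refine ⟨e '' {z | 0 < z.2 ∧ z.2 < z.1 ∧ z.1 < 1}, ?_, ?_, ⟨(s, t), ⟨h1, h2, h3⟩, hap _⟩⟩
  · rintro _ ⟨z, ⟨a, b, c⟩, rfl⟩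
    rw [hap, mem_tri A B C z hδ]
    exact ⟨a.le, b.le, c.le⟩
  · apply e.isOpenMap
    exact (isOpen_lt continuous_const continuous_snd).inter
      ((isOpen_lt continuous_snd continuous_fst).inter (isOpen_lt continuous_fst continuous_const))

lemma geom (A B C : Pt)
    (hSM : dist B C ≤ dist A C) (hML : dist A C ≤ dist A B)
    (hC : EuclideanGeometry.angle A C B < π / 2) :
    3 * ((C - B) 0 ^ 2 + (C - B) 1 ^ 2) ^ 2 ≤
      4 * ((B - A) 0 * (C - B) 1 - (B - A) 1 * (C - B) 0) ^ 2 := by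
  have hin : 0 < inner ℝ (A - C) (B - C) := by
    rw [EuclideanGeometry.angle] at hC
    simp only [vsub_eq_sub] at hC
    have h0 := InnerProductGeometry.cos_angle_mul_norm_mul_norm (A - C) (B - C)
    have h1 : 0 < Real.cos (InnerProductGeometry.angle (A - C) (B - C)) :=
      Real.cos_pos_of_mem_Ioo ⟨by linarith [InnerProductGeometry.angle_nonneg (A - C) (B - C), Real.pi_pos], hC⟩
    have hne1 : A - C ≠ 0 := by
      intro h; rw [h, InnerProductGeometry.angle_zero_left] at hC; exact lt_irrefl _ hC
    have hne2 : B - C ≠ 0 := by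
      intro h; rw [h, InnerProductGeometry.angle_zero_right] at hC; exact lt_irrefl _ hC
    rw [← h0]
    have := norm_pos_iff.2 hne1
    have := norm_pos_iff.2 hne2
    positivity
  simp only [EuclideanSpace.dist_eq, Fin.sum_univ_two, Real.dist_eq, sq_abs] at hSM hML
  rw [Real.sqrt_le_sqrt_iff (by positivity)] at hSM hML
  simp only [PiLp.inner_apply, Fin.sum_univ_two, PiLp.sub_apply, RCLike.inner_apply, conj_trivial] at *
  generalize hv0 : C 0 - B 0 = v0 at *
  generalize hv1 : C 1 - B 1 = v1 at *
  generalize hp0 : B 0 - A 0 = p0 at *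
  generalize hp1 : B 1 - A 1 = p1 at *
  rw [show B 0 - C 0 = -v0 by linarith, show B 1 - C 1 = -v1 by linarith,
    show A 0 - C 0 = -p0 - v0 by linarith, show A 1 - C 1 = -p1 - v1 by linarith] at *
  rw [show A 0 - B 0 = -p0 by linarith, show A 1 - B 1 = -p1 by linarith] at *
  obtain ⟨q, hq⟩ : ∃ q, q = v0 ^ 2 + v1 ^ 2 := ⟨_, rfl⟩
  obtain ⟨a, ha⟩ : ∃ a, a = -(p0 * v0 + p1 * v1) := ⟨_, rfl⟩
  obtain ⟨l, hl⟩ : ∃ l, l = p0 ^ 2 + p1 ^ 2 := ⟨_, rfl⟩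
  have e1 : (p0 * v1 - p1 * v0) ^ 2 = l * q - a ^ 2 := by rw [hq, ha, hl]; ring
  have f1 : 2 * a ≤ l := by nlinarith
  have f2 : q ≤ 2 * a := by nlinarith
  have f3 : a < q := by nlinarith
  have hq0 : 0 ≤ q := by rw [hq]; positivity
  rw [e1, ← hq]
  nlinarith [mul_le_mul_of_nonneg_right f1 hq0, mul_nonneg (sub_nonneg.2 f2) (sub_nonneg.2 f3.le)]

/-- if both angles adjacent to the shortest side `S = [B,C]` are strictly
less than `π/2`, then `λ₁^S ≤ λ₁^{L ∪ M}`. Sides: `S = [B,C]`, `M = [A,C]`, `L = [A,B]`. -/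
theorem lambda1_shortest_le (A B C : Pt)
    (hnd : AffineIndependent ℝ ![A, B, C])
    (hSM : dist B C ≤ dist A C) (hML : dist A C ≤ dist A B)
    (hB : EuclideanGeometry.angle A B C < π / 2)
    (hC : EuclideanGeometry.angle A C B < π / 2) :
    lambda1 (interior (convexHull ℝ {A, B, C})) (segment ℝ B C) ≤
      lambda1 (interior (convexHull ℝ {A, B, C})) (segment ℝ A B ∪ segment ℝ A C) := by
  have hδ := tri_det A B C hnd
  have hgeom := geom A B C hSM hML hC
  have hT : ∀ z : ℝ × ℝ, A + z.1 • (B - A) + z.2 • (C - B) ∈ convexHull ℝ {A, B, C} ↔ z ∈ TT :=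
    fun z => mem_tri A B C z hδ
  have hin := tri_interior A B C hδ
  have hKc : IsCompact (convexHull ℝ ({A, B, C} : Set Pt)) :=
    (Set.toFinite ({A, B, C} : Set Pt)).isCompact_convexHull ℝ
  have hKv : Convex ℝ (convexHull ℝ ({A, B, C} : Set Pt)) := convex_convexHull ℝ _
  have hABs : ∀ x ∈ segment ℝ A B ∪ segment ℝ A C,
      tF A (B - A) (C - B) x * (sF A (B - A) (C - B) x - tF A (B - A) (C - B) x) = 0 := by
    rintro x (hx | hx)
    · rw [segment_eq_image'] at hx
      obtain ⟨θ, hθ, rfl⟩ := hx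
      have h1 := tF_apply A (B - A) (C - B) hδ θ 0
      simp only [zero_smul, add_zero] at h1
      simp only [h1, zero_mul]
    · rw [segment_eq_image'] at hx
      obtain ⟨θ, hθ, rfl⟩ := hx
      have h0 : A + θ • (C - A) = A + θ • (B - A) + θ • (C - B) := by module
      simp only [h0, tF_apply A (B - A) (C - B) hδ, sF_apply A (B - A) (C - B) hδ, sub_self, mul_zero]
  have hBCs : ∀ x ∈ segment ℝ B C, 1 - sF A (B - A) (C - B) x = 0 := by
    intro x hx
    rw [segment_eq_image'] at hx
    obtain ⟨θ, hθ, rfl⟩ := hx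
    have h0 : B + θ • (C - B) = A + (1:ℝ) • (B - A) + θ • (C - B) := by module
    simp only [h0, sF_apply A (B - A) (C - B) hδ, sub_self]
  have hu0 : ∀ s : ℝ, 0 ≤ s → s ≤ 1 → A + s • (B - A) ∈ segment ℝ A B ∪ segment ℝ A C := by
    intro s h0 h1
    left
    rw [segment_eq_image']
    exact ⟨s, ⟨h0, h1⟩, rfl⟩
  have hu1 : ∀ s : ℝ, 0 ≤ s → s ≤ 1 →
      A + s • (B - A) + s • (C - B) ∈ segment ℝ A B ∪ segment ℝ A C := by
    intro s h0 h1
    right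
    rw [segment_eq_image']
    exact ⟨s, ⟨h0, h1⟩, by module⟩
  have hsa := sF_apply A (B - A) (C - B) hδ
  have hta := tF_apply A (B - A) (C - B) hδ
  have hsc := sF_contDiff A (B - A) (C - B)
  have htc := tF_contDiff A (B - A) (C - B)
  have hsd := sF_hasFDerivAt A (B - A) (C - B)
  have htest := test_int A (B - A) (C - B) hδ _ hT (fun x => 1 - sF A (B - A) (C - B) x)
    (fun s t => by simp only [hsa])
  have hdir := dirichlet_ineq A (B - A) (C - B) hδ _ hT hin
  have hvv : ∀ L : Pt →L[ℝ] ℝ, L (C - B) = (C - B) 0 * L (EuclideanSpace.single 0 1) +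
      (C - B) 1 * L (EuclideanSpace.single 1 1) := by
    intro L
    have : C - B = (C - B) 0 • EuclideanSpace.single 0 1 + (C - B) 1 • EuclideanSpace.single 1 1 := by
      ext i
      fin_cases i <;> simp
    conv_lhs => rw [this]
    simp only [map_add, map_smul, smul_eq_mul]
  set K : Set Pt := convexHull ℝ {A, B, C} with hK
  set sf := sF A (B - A) (C - B) with hsf
  set tf := tF A (B - A) (C - B) with htf
  generalize C - B = v at *
  generalize B - A = p at *
  have hx0 := hin (2/3) (1/3) (by norm_num) (by norm_num) (by norm_num)
  have hcl : closure (interior K) = K := by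
    rw [hKv.closure_interior_eq_closure_of_nonempty_interior ⟨_, hx0⟩, hKc.isClosed.closure_eq]
  have hae : (interior K : Set Pt) =ᵐ[volume] K :=
    interior_ae_eq_of_null_frontier (hKv.addHaar_frontier volume)
  have hres : (volume : Measure Pt).restrict (interior K) = volume.restrict K :=
    Measure.restrict_congr_set hae
  have hud : UniqueDiffOn ℝ K := uniqueDiffOn_convex hKv ⟨_, hx0⟩
  have hKpos : 0 < volume.real K := by
    rw [measureReal_def, ENNReal.toReal_pos_iff]
    exact ⟨(isOpen_interior.measure_pos volume ⟨_, hx0⟩).trans_le (measure_mono interior_subset),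
      hKc.measure_lt_top⟩
  set q := v 0 ^ 2 + v 1 ^ 2 with hq
  set δ := p 0 * v 1 - p 1 * v 0 with hδd
  have hq0 : 0 < q := by
    have : q ≠ 0 := by
      intro h
      have h0 : v 0 = 0 := by nlinarith [sq_nonneg (v 0), sq_nonneg (v 1)]
      have h1 : v 1 = 0 := by nlinarith [sq_nonneg (v 0), sq_nonneg (v 1)]
      apply hδ
      rw [hδd, h0, h1]; ring
    exact lt_of_le_of_ne (by positivity) this.symm
  have hδ2 : 0 < δ ^ 2 := by positivity
  unfold lambda1
  refine le_csInf ?_ ?_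
  · refine ⟨_, fun x => tf x * (sf x - tf x), ?_, hABs, ?_, rfl⟩
    · exact (htc.mul (hsc.sub htc)).contDiffOn
    · rw [hres]
      apply ne_of_gt
      have hcont : Continuous (fun x => (tf x * (sf x - tf x)) ^ 2) := by
        have := hsc.continuous
        have := htc.continuous
        fun_prop
      rw [setIntegral_pos_iff_support_of_nonneg_ae
        (Filter.Eventually.of_forall fun x => sq_nonneg _)
        (hcont.continuousOn.integrableOn_compact hKc)]
      refine lt_of_lt_of_le ?_ (measure_mono
        (Set.inter_subset_inter_right _ (interior_subset : interior K ⊆ K)))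
      apply (hcont.isOpen_support.inter isOpen_interior).measure_pos volume
      refine ⟨_, ?_, hx0⟩
      simp only [Function.mem_support, hsa, hta]
      norm_num
  · rintro r ⟨u, hu1', hu2', hu3', rfl⟩
    have hlow : 9 / q ≤ (∫ x in interior K, ((pd 0 u x) ^ 2 + (pd 1 u x) ^ 2)) /
        (∫ x in interior K, (u x) ^ 2) := by
      unfold MemH1 at hu1'
      rw [hcl] at hu1'
      have hDc : ContinuousOn (fun x => fderivWithin ℝ u K x) K :=
        hu1'.continuousOn_fderivWithin hud le_rfl
      have hDw : ∀ w : Pt, ContinuousOn (fun x => fderivWithin ℝ u K x w) K :=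
        fun w => hDc.clm_apply continuousOn_const
      have hDe : ∀ x ∈ interior K, fderivWithin ℝ u K x = fderiv ℝ u x :=
        fun x hx => fderivWithin_of_mem_nhds (mem_interior_iff_mem_nhds.1 hx)
      have hdd : ∀ x ∈ interior K, DifferentiableAt ℝ u x := fun x hx =>
        (hu1'.differentiableOn one_ne_zero x (interior_subset hx)).differentiableAt
          (mem_interior_iff_mem_nhds.1 hx)
      have h9 := hdir u hu1'.continuousOn hdd (fun x => fderivWithin ℝ u K x v) (hDw v)
        (fun x hx => by rw [hDe x hx]) (fun s a b => hu2' _ (hu0 s a b))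
        (fun s a b => hu2' _ (hu1 s a b))
      have hgrad : ∫ x in interior K, ((pd 0 u x) ^ 2 + (pd 1 u x) ^ 2) =
          ∫ x in K, ((fderivWithin ℝ u K x (EuclideanSpace.single 0 1)) ^ 2 +
            (fderivWithin ℝ u K x (EuclideanSpace.single 1 1)) ^ 2) := by
        rw [← hres]
        apply setIntegral_congr_fun isOpen_interior.measurableSet
        intro x hx
        simp only [pd, hDe x hx]
      rw [hgrad]
      rw [hres] at hu3' ⊢
      have hupos : 0 < ∫ x in K, (u x) ^ 2 :=
        lt_of_le_of_ne (integral_nonneg fun x => sq_nonneg _) (Ne.symm hu3')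
      have iu : IntegrableOn (fun x => (u x) ^ 2) K :=
        (hu1'.continuousOn.pow 2).integrableOn_compact hKc
      have iv : IntegrableOn (fun x => (fderivWithin ℝ u K x v) ^ 2) K :=
        ((hDw v).pow 2).integrableOn_compact hKc
      have ig : IntegrableOn (fun x => (fderivWithin ℝ u K x (EuclideanSpace.single 0 1)) ^ 2 +
            (fderivWithin ℝ u K x (EuclideanSpace.single 1 1)) ^ 2) K :=
        (((hDw _).pow 2).add ((hDw _).pow 2)).integrableOn_compact hKc
      rw [integral_sub iv (iu.const_mul 9), integral_const_mul] at h9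
      have hle : ∫ x in K, (fderivWithin ℝ u K x v) ^ 2 ≤
          ∫ x in K, q * ((fderivWithin ℝ u K x (EuclideanSpace.single 0 1)) ^ 2 +
            (fderivWithin ℝ u K x (EuclideanSpace.single 1 1)) ^ 2) := by
        apply integral_mono iv (ig.const_mul q)
        intro x
        dsimp only
        rw [hvv, hq]
        nlinarith [sq_nonneg (v 0 * fderivWithin ℝ u K x (EuclideanSpace.single 1 1) -
          v 1 * fderivWithin ℝ u K x (EuclideanSpace.single 0 1))]
      rw [integral_const_mul] at hle
      rw [div_le_div_iff₀ hq0 hupos]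
      linarith
    refine le_trans ?_ hlow
    have hup : 6 * q / δ ^ 2 ≤ 9 / q := by
      rw [div_le_div_iff₀ hδ2 hq0]
      nlinarith
    refine le_trans ?_ hup
    apply csInf_le
    · refine ⟨0, ?_⟩
      rintro _ ⟨w, _, _, _, rfl⟩
      exact div_nonneg (integral_nonneg fun x => by positivity) (integral_nonneg fun x => by positivity)
    · have iu : IntegrableOn (fun x => (1 - sf x) ^ 2) K := by
        have := hsc.continuous
        exact ContinuousOn.integrableOn_compact hKc (by fun_prop)
      have hval : 6 * ∫ x in K, (1 - sf x) ^ 2 = volume.real K := by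
        rw [integral_sub (iu.const_mul 6) (integrableOn_const hKc.measure_lt_top.ne),
          integral_const_mul] at htest
        simp at htest
        linarith
      have hp : ∀ x, pd 0 (fun x => 1 - sf x) x ^ 2 + pd 1 (fun x => 1 - sf x) x ^ 2 = q / δ ^ 2 := by
        intro x
        have h := (hsd x).const_sub 1
        simp only [pd, h.fderiv]
        simp
        rw [hq]
        ring
      refine ⟨fun x => 1 - sf x, (contDiff_const.sub hsc).contDiffOn, hBCs, ?_, ?_⟩
      · rw [hres]
        intro h0
        rw [h0] at hval
        linarith
      · simp only [hp]
        rw [hres, integral_const]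
        simp only [measureReal_restrict_apply_univ, smul_eq_mul]
        have hne : (∫ x in K, (1 - sf x) ^ 2) ≠ 0 := by
          intro h0
          rw [h0] at hval
          linarith
        rw [← hval]
        field_simp
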